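/- Let G = (V,E) be a finite loopless directed graph, let v ∈ V, let G' = G ∖ v be the induced subgraph on V' = V ∖ {v} with |V'| = n', and let π'_x : V' → {1, …, n'} be a bijection. For an insertion position i ∈ {1, …, n'+1}, define the bijection σ_i : V → {1, …, n'+1} by σ_i(u) = π'_x(u) if π'_x(u) < i, σ_i(u) = π'_x(u) + 1 if π'_x(u) ≥ i (for u ∈ V'), and σ_i(v) = i. For each w ∈ V' let W_w = min_{u ∈ N⁻_{G'}(w) ∪ {w}} π'_x(u) and E_w = max_{u ∈ N⁻_{G'}(w) ∪ {w}} π'_x(u), and let W'_w and E'_w denote these values after the shift (W'_w = W_w if W_w < i, else W_w + 1; likewise for E'_w). Then the horizontal ink of G under σ_i satisfies ink_x,G(σ_i) = ink_x,G'(π'_x) + Stretch(i) + Inc(i) + Out(i), where Stretch(i) = |{w ∈ V' : W_w < i ≤ E_w}|, Inc(i) = max({i} ∪ σ_i(N⁻_G(v))) − min({i} ∪ σ_i(N⁻_G(v))), and Out(i) = Σ_{u ∈ N⁺_G(v)} max(0, W'_u − i, i − E'_u). -/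

import Mathlib

open Finset
open scoped Classical

/-- `Wmin E x w = min_{u ∈ N⁻(w) ∪ {w}} x u`, the leftmost point of the
horizontal segment entering `w`. -/
noncomputable def Wmin {V : Type*} [Fintype V] (E : V → V → Prop) (x : V → ℤ) (w : V) : ℤ :=
  (insert w (Finset.univ.filter (fun u => E u w))).inf' (Finset.insert_nonempty _ _) x

/-- `Emax E x w = max_{u ∈ N⁻(w) ∪ {w}} x u`, the rightmost point of the
horizontal segment entering `w`. -/
noncomputable def Emax {V : Type*} [Fintype V] (E : V → V → Prop) (x : V → ℤ) (w : V) : ℤ :=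
  (insert w (Finset.univ.filter (fun u => E u w))).sup' (Finset.insert_nonempty _ _) x

/-- Horizontal ink of the graph `E` under the coordinate map `x`:
`Σ_w (max_{u ∈ N⁻(w) ∪ {w}} x u − min_{u ∈ N⁻(w) ∪ {w}} x u)`. -/
noncomputable def inkX {V : Type*} [Fintype V] (E : V → V → Prop) (x : V → ℤ) : ℤ :=
  ∑ w : V, (Emax E x w - Wmin E x w)

/-- The subgraph of `E` induced on `V ∖ {v}`. -/
def subE {V : Type*} (E : V → V → Prop) (v : V) :
    {u : V // u ≠ v} → {u : V // u ≠ v} → Prop :=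
  fun a b => E a.1 b.1

theorem le_Wmin_iff {V : Type*} [Fintype V] {E : V → V → Prop} {x : V → ℤ} {w : V} {c : ℤ} :
    c ≤ Wmin E x w ↔ c ≤ x w ∧ ∀ u, E u w → c ≤ x u := by
  simp [Wmin]

theorem Emax_le_iff {V : Type*} [Fintype V] {E : V → V → Prop} {x : V → ℤ} {w : V} {c : ℤ} :
    Emax E x w ≤ c ↔ x w ≤ c ∧ ∀ u, E u w → x u ≤ c := by
  simp [Emax]

theorem Wmin_le_Emax {V : Type*} [Fintype V] (E : V → V → Prop) (x : V → ℤ) (w : V) :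
    Wmin E x w ≤ Emax E x w :=
  (le_Wmin_iff.1 le_rfl).1.trans (Emax_le_iff.1 le_rfl).1

theorem le_shift_iff {a c i : ℤ} :
    c ≤ (if a < i then a else a + 1) ↔ (if c ≤ i then c else c - 1) ≤ a := by
  split_ifs <;> omega

theorem shift_le_iff {a c i : ℤ} :
    (if a < i then a else a + 1) ≤ c ↔ a ≤ (if c < i then c else c - 1) := by
  split_ifs <;> omega

section Insertion

variable {V : Type*} [Fintype V] {E : V → V → Prop} {v : V} {π' : {u : V // u ≠ v} → ℤ}
  {i : ℤ} {σ : V → ℤ}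

theorem Wmin_insertion (hσv : σ v = i)
    (hσ : ∀ (u : V) (h : u ≠ v),
      σ u = if π' ⟨u, h⟩ < i then π' ⟨u, h⟩ else π' ⟨u, h⟩ + 1)
    (w : {u : V // u ≠ v}) :
    Wmin E σ w =
      if E v w then
        min i (if Wmin (subE E v) π' w < i then Wmin (subE E v) π' w
          else Wmin (subE E v) π' w + 1)
      else if Wmin (subE E v) π' w < i then Wmin (subE E v) π' w
        else Wmin (subE E v) π' w + 1 := by
  refine eq_of_forall_le_iff fun c => ?_
  have key : c ≤ Wmin E σ w ↔ (E v w → c ≤ i) ∧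
      c ≤ (if Wmin (subE E v) π' w < i then Wmin (subE E v) π' w
        else Wmin (subE E v) π' w + 1) := by
    rw [le_shift_iff, le_Wmin_iff, le_Wmin_iff, hσ w w.2, le_shift_iff]
    constructor
    · rintro ⟨hw, h⟩
      refine ⟨fun hv => hσv ▸ h v hv, hw, fun u hu => ?_⟩
      have := h u hu
      rwa [hσ u u.2, le_shift_iff] at this
    · rintro ⟨hv, hw, h⟩
      refine ⟨hw, fun u hu => ?_⟩
      by_cases huv : u = v
      · subst huv
        exact hσv ▸ hv hu
      · rw [hσ u huv, le_shift_iff]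
        exact h ⟨u, huv⟩ hu
  rw [key]
  by_cases hv : E v w
  · rw [if_pos hv, le_min_iff]
    simp only [hv, true_imp_iff]
  · rw [if_neg hv]
    simp only [hv, false_imp_iff, true_and]

theorem Emax_insertion (hσv : σ v = i)
    (hσ : ∀ (u : V) (h : u ≠ v),
      σ u = if π' ⟨u, h⟩ < i then π' ⟨u, h⟩ else π' ⟨u, h⟩ + 1)
    (w : {u : V // u ≠ v}) :
    Emax E σ w =
      if E v w then
        max i (if Emax (subE E v) π' w < i then Emax (subE E v) π' w
          else Emax (subE E v) π' w + 1)
      else if Emax (subE E v) π' w < i then Emax (subE E v) π' w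
        else Emax (subE E v) π' w + 1 := by
  refine eq_of_forall_ge_iff fun c => ?_
  have key : Emax E σ w ≤ c ↔ (E v w → i ≤ c) ∧
      (if Emax (subE E v) π' w < i then Emax (subE E v) π' w
        else Emax (subE E v) π' w + 1) ≤ c := by
    rw [shift_le_iff, Emax_le_iff, Emax_le_iff, hσ w w.2, shift_le_iff]
    constructor
    · rintro ⟨hw, h⟩
      refine ⟨fun hv => hσv ▸ h v hv, hw, fun u hu => ?_⟩
      have := h u hu
      rwa [hσ u u.2, shift_le_iff] at this
    · rintro ⟨hv, hw, h⟩
      refine ⟨hw, fun u hu => ?_⟩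
      by_cases huv : u = v
      · subst huv
        exact hσv ▸ hv hu
      · rw [hσ u huv, shift_le_iff]
        exact h ⟨u, huv⟩ hu
  rw [key]
  by_cases hv : E v w
  · rw [if_pos hv, max_le_iff]
    simp only [hv, true_imp_iff]
  · rw [if_neg hv]
    simp only [hv, false_imp_iff, true_and]

end Insertion

/-- Let `G' = G ∖ v` with `|V'| = n'` and let `π'` be a bijection
`V' → {1, …, n'}`. For an insertion position `i ∈ {1, …, n'+1}` let `σ` be the
map placing `v` at position `i` and shifting the old positions `≥ i` up by one.
With `W_w, E_w` the extremes of the horizontal segment entering `w` in `G'` under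
`π'` and `W'_w, E'_w` their shifted values, the horizontal ink of `G` under `σ`
equals the horizontal ink of `G'` under `π'` plus
`Stretch(i) = #{w : W_w < i ≤ E_w}`, plus
`Inc(i) = max({i} ∪ σ(N⁻(v))) − min({i} ∪ σ(N⁻(v)))`, plus
`Out(i) = Σ_{u ∈ N⁺(v)} max(0, W'_u − i, i − E'_u)`. -/
theorem stmt11 {V : Type*} [Fintype V] (E : V → V → Prop)
    (hloopless : ∀ u, ¬ E u u) (v : V)
    (n' : ℕ) (hn' : Fintype.card {u : V // u ≠ v} = n')
    (π' : {u : V // u ≠ v} → ℤ)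
    (hπ' : Set.BijOn π' Set.univ (Set.Icc 1 (n' : ℤ)))
    (i : ℤ) (hi : i ∈ Set.Icc 1 ((n' : ℤ) + 1))
    (σ : V → ℤ) (hσv : σ v = i)
    (hσ : ∀ (u : V) (h : u ≠ v),
      σ u = if π' ⟨u, h⟩ < i then π' ⟨u, h⟩ else π' ⟨u, h⟩ + 1) :
    inkX E σ =
      inkX (subE E v) π' +
      ((Finset.univ.filter (fun w : {u : V // u ≠ v} =>
          Wmin (subE E v) π' w < i ∧ i ≤ Emax (subE E v) π' w)).card : ℤ) +
      ((insert i ((Finset.univ.filter (fun u : V => E u v)).image σ)).max'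
          (Finset.insert_nonempty _ _) -
       (insert i ((Finset.univ.filter (fun u : V => E u v)).image σ)).min'
          (Finset.insert_nonempty _ _)) +
      ∑ u ∈ Finset.univ.filter (fun u : {u : V // u ≠ v} => E v u.1),
        max 0 (max
          ((if Wmin (subE E v) π' u < i then Wmin (subE E v) π' u
            else Wmin (subE E v) π' u + 1) - i)
          (i - (if Emax (subE E v) π' u < i then Emax (subE E v) π' u
                else Emax (subE E v) π' u + 1))) := by
  have hmax : (insert i ((Finset.univ.filter (fun u : V => E u v)).image σ)).max'
      (Finset.insert_nonempty _ _) = Emax E σ v :=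
    eq_of_forall_ge_iff fun c => by simp [Emax_le_iff, Finset.max'_le_iff, hσv]
  have hmin : (insert i ((Finset.univ.filter (fun u : V => E u v)).image σ)).min'
      (Finset.insert_nonempty _ _) = Wmin E σ v :=
    eq_of_forall_le_iff fun c => by simp [le_Wmin_iff, Finset.le_min'_iff, hσv]
  have hsplit : inkX E σ = (Emax E σ v - Wmin E σ v) +
      ∑ w : {u : V // u ≠ v}, (Emax E σ w - Wmin E σ w) :=
    Fintype.sum_eq_add_sum_subtype_ne (fun w => Emax E σ w - Wmin E σ w) v
  have hsum : ∑ w : {u : V // u ≠ v}, (Emax E σ w - Wmin E σ w) =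
      inkX (subE E v) π' +
      ((Finset.univ.filter (fun w : {u : V // u ≠ v} =>
          Wmin (subE E v) π' w < i ∧ i ≤ Emax (subE E v) π' w)).card : ℤ) +
      ∑ u ∈ Finset.univ.filter (fun u : {u : V // u ≠ v} => E v u.1),
        max 0 (max
          ((if Wmin (subE E v) π' u < i then Wmin (subE E v) π' u
            else Wmin (subE E v) π' u + 1) - i)
          (i - (if Emax (subE E v) π' u < i then Emax (subE E v) π' u
                else Emax (subE E v) π' u + 1))) := by
    rw [Finset.card_filter, Nat.cast_sum, Finset.sum_filter, inkX, ← Finset.sum_add_distrib,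
      ← Finset.sum_add_distrib]
    refine Finset.sum_congr rfl fun w _ => ?_
    rw [Wmin_insertion hσv hσ, Emax_insertion hσv hσ]
    have hle := Wmin_le_Emax (subE E v) π' w
    generalize Wmin (subE E v) π' w = a at hle ⊢
    generalize Emax (subE E v) π' w = b at hle ⊢
    push_cast
    split_ifs <;> omega
  rw [hmax, hmin, hsplit, hsum]
  ring
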